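/- (Proposition 3, identification of joint counterfactual distribution under strong time invariance.) Let U be a real-valued random variable on a probability space, let h₀, h₁ : ℝ → ℝ be strictly increasing bijections, set X₀ := h₀(U) and X₁ := h₁(U), and let Z be any real-valued random variable on the same probability space. Assume X₀ and X₁ take values in a compact interval [a,b] and their CDFs F₀ and F₁, restricted to [a,b], are continuous and strictly increasing from [a,b] onto [0,1]. Then for every y⁰ ∈ [a,b] and every y¹ ∈ ℝ: P(X₁ ≤ y⁰, Z ≤ y¹) = P(X₀ ≤ F₀⁻¹(F₁(y⁰)), Z ≤ y¹), where F₀⁻¹(u) := inf{z ∈ [a,b] : F₀(z) ≥ u}. -/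

import Mathlib

open MeasureTheory Set

/- The generalized inverse of `F` on the interval `[a,b]`:
`F⁻¹(u) := inf {y ∈ [a,b] | F y ≥ u}`, defined to be `b` when this set is empty. -/
open Classical in
noncomputable def genInv (F : ℝ → ℝ) (a b u : ℝ) : ℝ :=
  if ({y : ℝ | y ∈ Set.Icc a b ∧ u ≤ F y}).Nonempty then
    sInf {y : ℝ | y ∈ Set.Icc a b ∧ u ≤ F y}
  else b

/-- On an interval where `F` is strictly increasing, `genInv F` inverts `F`. -/
lemma genInv_apply_of_strictMonoOn {F : ℝ → ℝ} {a b z : ℝ}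
    (hF : StrictMonoOn F (Set.Icc a b)) (hz : z ∈ Set.Icc a b) :
    genInv F a b (F z) = z := by
  have hleast : IsLeast {y : ℝ | y ∈ Set.Icc a b ∧ F z ≤ F y} z :=
    ⟨⟨hz, le_rfl⟩, fun _ hy => (hF.le_iff_le hz hy.1).1 hy.2⟩
  rw [genInv, if_pos hleast.nonempty, hleast.csInf_eq]

/-- Two sublevel sets of a random variable with the same probability agree almost everywhere. -/
lemma setOf_le_ae_eq_of_measure_eq {Ω : Type*} [MeasurableSpace Ω] {P : Measure Ω}
    [IsFiniteMeasure P] {U : Ω → ℝ} (hU : Measurable U) {s t : ℝ}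
    (h : P {ω | U ω ≤ s} = P {ω | U ω ≤ t}) :
    ({ω | U ω ≤ s} : Set Ω) =ᵐ[P] {ω | U ω ≤ t} := by
  have hmeas (r : ℝ) : NullMeasurableSet {ω | U ω ≤ r} P :=
    (measurableSet_le hU measurable_const).nullMeasurableSet
  rcases le_total s t with hst | hts
  · exact ae_eq_of_subset_of_measure_ge (fun _ hω => le_trans hω hst) h.ge (hmeas s)
      (measure_ne_top P _)
  · exact (ae_eq_of_subset_of_measure_ge (fun _ hω => le_trans hω hts) h.le (hmeas t)
      (measure_ne_top P _)).symm

/-- Proposition 3, identification of joint counterfactual distribution under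
strong time invariance: `U` is a latent real random variable, `h₀, h₁` are strictly
increasing bijections of `ℝ`, `X₀ = h₀(U)` and `X₁ = h₁(U)` take values in `[a,b]` and
have CDFs `F₀, F₁` that are continuous and strictly increasing from `[a,b]` onto `[0,1]`,
and `Z` is any real random variable on the same space.  Then for every `y⁰ ∈ [a,b]` and
`y¹ ∈ ℝ`, `P(X₁ ≤ y⁰, Z ≤ y¹) = P(X₀ ≤ F₀⁻¹(F₁(y⁰)), Z ≤ y¹)`. -/
theorem joint_counterfactual_identification
    {Ω : Type*} [MeasurableSpace Ω] (P : Measure Ω) [IsProbabilityMeasure P]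
    (a b : ℝ) (hab : a ≤ b)
    (U Z : Ω → ℝ) (hU : Measurable U) (hZ : Measurable Z)
    (h₀ h₁ : ℝ → ℝ)
    (h₀mono : StrictMono h₀) (h₀bij : Function.Bijective h₀)
    (h₁mono : StrictMono h₁) (h₁bij : Function.Bijective h₁)
    (F₀ F₁ : ℝ → ℝ)
    (hF₀ : ∀ y, F₀ y = (P {ω | h₀ (U ω) ≤ y}).toReal)
    (hF₁ : ∀ y, F₁ y = (P {ω | h₁ (U ω) ≤ y}).toReal)
    (hsupp₀ : ∀ ω, h₀ (U ω) ∈ Set.Icc a b)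
    (hsupp₁ : ∀ ω, h₁ (U ω) ∈ Set.Icc a b)
    (hcont₀ : ContinuousOn F₀ (Set.Icc a b))
    (hstrict₀ : StrictMonoOn F₀ (Set.Icc a b))
    (himg₀ : F₀ '' Set.Icc a b = Set.Icc (0 : ℝ) 1)
    (hcont₁ : ContinuousOn F₁ (Set.Icc a b))
    (hstrict₁ : StrictMonoOn F₁ (Set.Icc a b))
    (himg₁ : F₁ '' Set.Icc a b = Set.Icc (0 : ℝ) 1)
    (y0 : ℝ) (hy0 : y0 ∈ Set.Icc a b) (y1 : ℝ) :
    (P {ω | h₁ (U ω) ≤ y0 ∧ Z ω ≤ y1}).toReal =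
      (P {ω | h₀ (U ω) ≤ genInv F₀ a b (F₁ y0) ∧ Z ω ≤ y1}).toReal := by
  obtain ⟨z, hz, hFz⟩ : F₁ y0 ∈ F₀ '' Set.Icc a b :=
    himg₀ ▸ himg₁ ▸ Set.mem_image_of_mem F₁ hy0
  rw [← hFz, genInv_apply_of_strictMonoOn hstrict₀ hz]
  obtain ⟨s, rfl⟩ := h₁bij.surjective y0
  obtain ⟨t, rfl⟩ := h₀bij.surjective z
  rw [hF₀, hF₁] at hFz
  simp only [h₀mono.le_iff_le, h₁mono.le_iff_le] at hFz ⊢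
  have hP : P {ω | U ω ≤ s} = P {ω | U ω ≤ t} :=
    ((ENNReal.toReal_eq_toReal_iff' (measure_ne_top P _) (measure_ne_top P _)).1 hFz).symm
  exact congrArg ENNReal.toReal <| measure_congr <|
    (setOf_le_ae_eq_of_measure_eq hU hP).inter (ae_eq_refl {ω | Z ω ≤ y1})
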